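/- arXiv:2502.15659 — 2 statements merged into one kernel-verified Lean document; each statement's English description precedes it below -/
import Mathlib

section
/- If σ ∈ Rains(A:B) and σ' ∈ Rains(A':B'), then σ ⊗ σ' ∈ Rains(AA':BB'), where the Kronecker product is reindexed so that the bipartition is (A×A') versus (B×B') and the partial transpose is taken over B×B'. -/
open scoped Kronecker ComplexOrder Matrix

attribute [local instance] Classical.propDecidable

noncomputable section

namespace QIT

variable {n : Type*} [Fintype n] [DecidableEq n]

/-- Base-2 matrix logarithm taken on the support (junk value `0` for non-Hermitian input). -/
def matLog (A : Matrix n n ℂ) : Matrix n n ℂ :=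
  if hA : A.IsHermitian then
    (hA.eigenvectorUnitary : Matrix n n ℂ) *
      Matrix.diagonal (fun i => if hA.eigenvalues i = 0 then (0 : ℂ)
        else (Real.logb 2 (hA.eigenvalues i) : ℂ)) *
      (hA.eigenvectorUnitary : Matrix n n ℂ)ᴴ
  else 0

/-- Orthogonal projection onto the support of a Hermitian matrix. -/
def suppProj (A : Matrix n n ℂ) : Matrix n n ℂ :=
  if hA : A.IsHermitian then
    (hA.eigenvectorUnitary : Matrix n n ℂ) *
      Matrix.diagonal (fun i => if hA.eigenvalues i = 0 then (0 : ℂ) else 1) *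
      (hA.eigenvectorUnitary : Matrix n n ℂ)ᴴ
  else 0

/-- Support inclusion `supp ρ ⊆ supp σ`, phrased via kernels. -/
def suppLE (ρ σ : Matrix n n ℂ) : Prop :=
  ∀ x : n → ℂ, σ.mulVec x = 0 → ρ.mulVec x = 0

/-- Umegaki relative entropy (base 2), `+∞` when supports are not included. -/
def relEnt (ρ σ : Matrix n n ℂ) : EReal :=
  if suppLE ρ σ then (((ρ * (matLog ρ - matLog σ)).trace).re : EReal) else ⊤

/-- Classical relative-entropy summand `p log₂(p/q)` with conventions
`0 · log(0/q) = 0` and `p · log(p/0) = +∞` for `p ≠ 0`. -/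
def klTerm (p q : ℝ) : EReal :=
  if p = 0 then 0 else if q = 0 then ⊤ else ((p * Real.logb 2 (p / q) : ℝ) : EReal)

/-- A finite POVM. -/
def IsPOVM {m : ℕ} (M : Fin m → Matrix n n ℂ) : Prop :=
  (∀ x, (M x).PosSemidef) ∧ ∑ x, M x = 1

/-- Measured relative entropy (base 2). -/
def measRelEnt (ρ σ : Matrix n n ℂ) : EReal :=
  ⨆ (m : ℕ) (M : Fin m → Matrix n n ℂ) (_ : IsPOVM M),
    ∑ x, klTerm ((M x * ρ).trace).re ((M x * σ).trace).re

/-- Trace norm: sum of singular values. -/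
def traceNorm (A : Matrix n n ℂ) : ℝ :=
  ∑ i, Real.sqrt ((Matrix.posSemidef_conjTranspose_mul_self A).1.eigenvalues i)

/-- Operator (spectral) norm: largest singular value. -/
def opNorm (A : Matrix n n ℂ) : ℝ :=
  ⨆ i, Real.sqrt ((Matrix.posSemidef_conjTranspose_mul_self A).1.eigenvalues i)

/-- Partial transpose on the second tensor factor. -/
def ptB {α β : Type*} (X : Matrix (α × β) (α × β) ℂ) : Matrix (α × β) (α × β) ℂ :=
  Matrix.of fun p q => X (p.1, q.2) (q.1, p.2)

/-- Kronecker product of two bipartite matrices, reindexed to the bipartition (A×A') : (B×B'). -/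
def kron2 {α β γ δ : Type*} (X : Matrix (α × β) (α × β) ℂ) (Y : Matrix (γ × δ) (γ × δ) ℂ) :
    Matrix ((α × γ) × β × δ) ((α × γ) × β × δ) ℂ :=
  Matrix.reindex (Equiv.prodProdProdComm α β γ δ) (Equiv.prodProdProdComm α β γ δ) (X ⊗ₖ Y)

/-- The permutation unitary on `(ℂ^d)^{⊗ m}`. -/
def permMat (d m : ℕ) (π : Equiv.Perm (Fin m)) :
    Matrix (Fin m → Fin d) (Fin m → Fin d) ℂ :=
  Matrix.of fun f g => if f ∘ π = g then 1 else 0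

/-- Membership in the `PPT_k` set. -/
def memPPTk {α β : Type*} [Fintype α] [Fintype β] [DecidableEq α] [DecidableEq β]
    (k : ℕ) (X : Matrix (α × β) (α × β) ℂ) : Prop :=
  X.PosSemidef ∧ ∃ ω : ℕ → Matrix (α × β) (α × β) ℂ,
    ω 1 = X ∧ (∀ i ∈ Finset.Icc 1 k, (ω i).IsHermitian) ∧
    (∀ i ∈ Finset.Icc 1 (k - 1),
      ((ω (i + 1)) - ptB (ω i)).PosSemidef ∧ ((ω (i + 1)) + ptB (ω i)).PosSemidef) ∧
    traceNorm (ptB (ω k)) ≤ 1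

/-- Membership in the Rains set. -/
def memRains {α β : Type*} [Fintype α] [Fintype β] [DecidableEq α] [DecidableEq β]
    (σ : Matrix (α × β) (α × β) ℂ) : Prop :=
  σ.PosSemidef ∧ traceNorm (ptB σ) ≤ 1


theorem traceNorm_eq_sum_sqrt_of_charpoly {ι : Type*} [Fintype ι] (A : Matrix n n ℂ) (f : ι → ℝ)
    (h : (Aᴴ * A).charpoly = ∏ i, (Polynomial.X - Polynomial.C (f i : ℂ))) :
    traceNorm A = ∑ i, Real.sqrt (f i) := by
  have hA := (Matrix.posSemidef_conjTranspose_mul_self A).1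
  have h_roots : Multiset.map (fun i => (hA.eigenvalues i : ℂ)) Finset.univ.val =
      Multiset.map (fun i => (f i : ℂ)) Finset.univ.val := by
    have h_eig := hA.roots_charpoly_eq_eigenvalues
    rw [h, Polynomial.roots_prod _ _
      (Finset.prod_ne_zero_iff.mpr fun i _ => Polynomial.X_sub_C_ne_zero _)] at h_eig
    simpa [Function.comp_def] using h_eig.symm
  have h_sum := congrArg (fun s : Multiset ℂ => (s.map fun z => Real.sqrt z.re).sum) h_roots
  simpa [Multiset.map_map, Function.comp_def, traceNorm] using h_sum

theorem charpoly_kronecker_of_isHermitian {m : Type*} [Fintype m] [DecidableEq m]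
    {M : Matrix m m ℂ} {N : Matrix n n ℂ} (hM : M.IsHermitian) (hN : N.IsHermitian) :
    (M ⊗ₖ N).charpoly = ∏ p : m × n, (Polynomial.X -
      Polynomial.C ((hM.eigenvalues p.1 * hN.eigenvalues p.2 : ℝ) : ℂ)) := by
  conv_lhs => rw [hM.spectral_theorem, hN.spectral_theorem, Unitary.conjStarAlgAut_apply,
    Unitary.conjStarAlgAut_apply, Matrix.mul_kronecker_mul, Matrix.charpoly_mul_comm,
    Matrix.mul_kronecker_mul, ← mul_assoc, ← Matrix.mul_kronecker_mul]
  simp [Matrix.diagonal_kronecker_diagonal, Matrix.charpoly_diagonal]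

theorem traceNorm_kronecker {m : Type*} [Fintype m] [DecidableEq m]
    (A : Matrix m m ℂ) (B : Matrix n n ℂ) :
    traceNorm (A ⊗ₖ B) = traceNorm A * traceNorm B := by
  have hA := Matrix.posSemidef_conjTranspose_mul_self A
  have hB := Matrix.posSemidef_conjTranspose_mul_self B
  rw [traceNorm_eq_sum_sqrt_of_charpoly (A ⊗ₖ B)
    (fun p : m × n => hA.1.eigenvalues p.1 * hB.1.eigenvalues p.2)
    (by rw [Matrix.conjTranspose_kronecker, ← Matrix.mul_kronecker_mul,
      charpoly_kronecker_of_isHermitian hA.1 hB.1])]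
  simp only [traceNorm, Fintype.sum_prod_type, Finset.sum_mul_sum]
  simp_rw [Real.sqrt_mul (hA.eigenvalues_nonneg _)]

theorem traceNorm_reindex {m : Type*} [Fintype m] [DecidableEq m] (e : n ≃ m)
    (A : Matrix n n ℂ) : traceNorm (Matrix.reindex e e A) = traceNorm A := by
  refine traceNorm_eq_sum_sqrt_of_charpoly _ _ ?_
  rw [Matrix.conjTranspose_reindex, Matrix.reindex_apply, Matrix.reindex_apply,
    Matrix.submatrix_mul_equiv, ← Matrix.reindex_apply, Matrix.charpoly_reindex]
  exact (Matrix.posSemidef_conjTranspose_mul_self A).1.charpoly_eq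

theorem traceNorm_nonneg (A : Matrix n n ℂ) : 0 ≤ traceNorm A :=
  Finset.sum_nonneg fun _ _ => Real.sqrt_nonneg _

theorem ptB_kron2 {α β γ δ : Type*} (X : Matrix (α × β) (α × β) ℂ)
    (Y : Matrix (γ × δ) (γ × δ) ℂ) : ptB (kron2 X Y) = kron2 (ptB X) (ptB Y) :=
  rfl

/-- the Rains sets are closed under (reindexed) tensor products. -/
theorem rains_tensor_closed {dA dB dA' dB' : ℕ}
    (σ : Matrix (Fin dA × Fin dB) (Fin dA × Fin dB) ℂ)
    (σ' : Matrix (Fin dA' × Fin dB') (Fin dA' × Fin dB') ℂ)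
    (hσ : memRains σ) (hσ' : memRains σ') :
    memRains (kron2 σ σ') := by
  refine ⟨(hσ.1.kronecker hσ'.1).submatrix _, ?_⟩
  rw [ptB_kron2, kron2, traceNorm_reindex, traceNorm_kronecker]
  exact mul_le_one₀ hσ.2 (traceNorm_nonneg _) hσ'.2

end QIT
end
end

section
/- Let d, m ≥ 1. The complex dimension of the space I_m := {X a complex matrix on (ℂ^d)^{⊗m} : P_π X P_π† = X for all π ∈ S_m} of permutation-invariant operators is at most (m+1)^{d²}. -/
open scoped Kronecker ComplexOrder Matrix

attribute [local instance] Classical.propDecidable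

noncomputable section

namespace QIT

variable {n : Type*} [Fintype n] [DecidableEq n]

/-- The space `I_m` of permutation-invariant operators on `(ℂ^d)^{⊗m}`, as a
`ℂ`-submodule of the matrices. -/
def invariantSubmodule (d m : ℕ) :
    Submodule ℂ (Matrix (Fin m → Fin d) (Fin m → Fin d) ℂ) where
  carrier := {X | ∀ π : Equiv.Perm (Fin m), permMat d m π * X * (permMat d m π)ᴴ = X}
  add_mem' := by
    intro a b ha hb π
    rw [Matrix.mul_add, Matrix.add_mul, ha π, hb π]
  zero_mem' := by
    intro π
    rw [Matrix.mul_zero, Matrix.zero_mul]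
  smul_mem' := by
    intro c X hX π
    rw [Matrix.mul_smul, Matrix.smul_mul, hX π]

theorem permMat_mul_mul_conjTranspose_apply (d m : ℕ) (π : Equiv.Perm (Fin m))
    (X : Matrix (Fin m → Fin d) (Fin m → Fin d) ℂ) (f g : Fin m → Fin d) :
    (permMat d m π * X * (permMat d m π)ᴴ) f g = X (f ∘ π) (g ∘ π) := by
  simp [permMat, Matrix.mul_apply, Matrix.conjTranspose_apply, apply_ite]

/-- The joint type of a pair of words: how often each pair of letters occurs. -/
def jointType (d m : ℕ) (p : (Fin m → Fin d) × (Fin m → Fin d)) :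
    Fin d × Fin d → Fin (m + 1) := fun ab =>
  ⟨Nat.card {i // (p.1 i, p.2 i) = ab},
    Nat.lt_succ_of_le ((Finite.card_subtype_le _).trans_eq (Nat.card_fin m))⟩

theorem exists_perm_of_jointType_eq {d m : ℕ} {p q : (Fin m → Fin d) × (Fin m → Fin d)}
    (h : jointType d m p = jointType d m q) :
    ∃ π : Equiv.Perm (Fin m), p.1 = q.1 ∘ π ∧ p.2 = q.2 ∘ π := by
  have hcard (ab : Fin d × Fin d) :
      Nat.card {i // (p.1 i, p.2 i) = ab} = Nat.card {i // (q.1 i, q.2 i) = ab} :=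
    congrArg Fin.val (congrFun h ab)
  let e (ab : Fin d × Fin d) : {i // (p.1 i, p.2 i) = ab} ≃ {i // (q.1 i, q.2 i) = ab} :=
    (Finite.card_eq.1 (hcard ab)).some
  have he (i : Fin m) := Equiv.ofFiberEquiv_map e i
  exact ⟨Equiv.ofFiberEquiv e, funext fun i => congrArg Prod.fst (he i).symm,
    funext fun i => congrArg Prod.snd (he i).symm⟩

theorem apply_eq_of_jointType_eq {d m : ℕ} {X : Matrix (Fin m → Fin d) (Fin m → Fin d) ℂ}
    (hX : X ∈ invariantSubmodule d m) {p q : (Fin m → Fin d) × (Fin m → Fin d)}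
    (h : jointType d m p = jointType d m q) : X p.1 p.2 = X q.1 q.2 := by
  obtain ⟨π, h₁, h₂⟩ := exists_perm_of_jointType_eq h
  rw [h₁, h₂]
  exact (permMat_mul_mul_conjTranspose_apply d m π X q.1 q.2).symm.trans
    (congrFun (congrFun (hX π) q.1) q.2)

/-- the dimension of the space of permutation-invariant operators on
`(ℂ^d)^{⊗m}` is at most `(m+1)^{d²}`. -/
theorem invariant_dim_le (d m : ℕ) (hd : 1 ≤ d) (hm : 1 ≤ m) :
    Module.finrank ℂ (invariantSubmodule d m) ≤ (m + 1) ^ (d ^ 2) := by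
  have : Nonempty (Fin d) := ⟨⟨0, hd⟩⟩
  let s := Function.invFun (jointType d m)
  let Φ : invariantSubmodule d m →ₗ[ℂ] (Fin d × Fin d → Fin (m + 1)) → ℂ :=
    { toFun := fun X t => X.1 (s t).1 (s t).2
      map_add' := fun _ _ => rfl
      map_smul' := fun _ _ => rfl }
  have hΦ : Function.Injective Φ := by
    intro X Y hXY
    ext f g
    have hs : jointType d m (f, g) = jointType d m (s (jointType d m (f, g))) :=
      (Function.invFun_eq ⟨_, rfl⟩).symm
    exact (apply_eq_of_jointType_eq X.2 hs).trans
      ((congrFun hXY _).trans (apply_eq_of_jointType_eq Y.2 hs).symm)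
  refine (LinearMap.finrank_le_finrank_of_injective hΦ).trans_eq ?_
  rw [Module.finrank_fintype_fun_eq_card]
  simp [sq]

end QIT
end
end
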